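/- Let {x^k} be generated by Algorithm 1 and suppose Assumption 2 holds. Then for each cluster point x̄ ∈ ω(x⁰) there exists a subsequence {x^{k_ν}} with x^{k_ν} → x̄ and F(x^{k_ν}) → F(x̄) as ν → ∞; consequently F(x̄) = lim_{k→∞} F(x^k) for every x̄ ∈ ω(x⁰), i.e., F is constant on ω(x⁰). -/

import Mathlib

open Filter Metric Real Set
open scoped InnerProductSpace Topology Pointwise

/-- The convex subdifferential of an extended-real-valued function `g` at `x`. -/
noncomputable def ESubdiff {X : Type*} [NormedAddCommGroup X] [InnerProductSpace ℝ X]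
    (g : X → EReal) (x : X) : Set X :=
  {v | ∀ z : X, g x + ((⟪v, z - x⟫_ℝ : ℝ) : EReal) ≤ g z}

/-- Second-order Taylor upper bound on a convex set where the Hessian is Lipschitz. -/
theorem le_taylor_two_of_lipschitz_hessian
    {X : Type*} [NormedAddCommGroup X] [InnerProductSpace ℝ X] [CompleteSpace X]
    {f : X → ℝ} {f' : X → X} {f'' : X → X →L[ℝ] X} {S : Set X} (hS : Convex ℝ S)
    (hf1 : ∀ z ∈ S, HasGradientAt f (f' z) z) (hf2 : ∀ z ∈ S, HasFDerivAt f' (f'' z) z)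
    {K : ℝ} (hK : 0 ≤ K) (hLip : ∀ a ∈ S, ∀ b ∈ S, ‖f'' a - f'' b‖ ≤ K * ‖a - b‖)
    {a b : X} (ha : a ∈ S) (hb : b ∈ S) :
    f b ≤ f a + ⟪f' a, b - a⟫_ℝ + 1/2 * ⟪b - a, f'' a (b - a)⟫_ℝ + K * ‖b - a‖ ^ 3 := by
  set h := b - a with hh
  have hseg : ∀ t ∈ Icc (0:ℝ) 1, a + t • h ∈ S := fun t ht =>
    hS.add_smul_sub_mem ha hb ht
  have hgrad : ∀ t ∈ Icc (0:ℝ) 1,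
      ‖f' (a + t • h) - f' a - t • f'' a h‖ ≤ K * ‖h‖ * ‖h‖ := by
    intro t ht
    have hderiv : ∀ s ∈ Icc (0:ℝ) 1, HasDerivWithinAt (fun s : ℝ => f' (a + s • h) - s • f'' a h)
        (f'' (a + s • h) h - f'' a h) (Icc 0 1) s := by
      intro s hs
      have h1 : HasDerivAt (fun s : ℝ => a + s • h) h s := by
        simpa using ((hasDerivAt_id s).smul_const h).const_add a
      have h2 := (hf2 _ (hseg s hs)).comp_hasDerivAt s h1
      have h3 : HasDerivAt (fun s : ℝ => s • f'' a h) (f'' a h) s := by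
        simpa using (hasDerivAt_id s).smul_const (f'' a h)
      exact (h2.sub h3).hasDerivWithinAt
    have hbound : ∀ s ∈ Icc (0:ℝ) 1, ‖f'' (a + s • h) h - f'' a h‖ ≤ K * ‖h‖ * ‖h‖ := by
      intro s hs
      rw [← sub_apply]
      refine (ContinuousLinearMap.le_opNorm _ _).trans ?_
      refine mul_le_mul_of_nonneg_right ?_ (norm_nonneg _)
      refine (hLip _ (hseg s hs) _ ha).trans ?_
      refine mul_le_mul_of_nonneg_left ?_ hK
      rw [add_sub_cancel_left, norm_smul, Real.norm_of_nonneg hs.1]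
      exact mul_le_of_le_one_left (norm_nonneg _) hs.2
    have := (convex_Icc (0:ℝ) 1).norm_image_sub_le_of_norm_hasDerivWithin_le hderiv hbound
      (left_mem_Icc.2 zero_le_one) ht
    simp only [zero_smul, add_zero, sub_zero, Real.norm_of_nonneg ht.1] at this
    rw [sub_right_comm]
    refine this.trans (mul_le_of_le_one_right (by positivity) ht.2)
  have hderiv : ∀ t ∈ Icc (0:ℝ) 1, HasDerivWithinAt
      (fun t : ℝ => f (a + t • h) - t * ⟪f' a, h⟫_ℝ - t ^ 2 * (1/2 * ⟪h, f'' a h⟫_ℝ))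
      (⟪f' (a + t • h) - f' a - t • f'' a h, h⟫_ℝ) (Icc 0 1) t := by
    intro t ht
    have h1 : HasDerivAt (fun s : ℝ => a + s • h) h t := by
      simpa using ((hasDerivAt_id t).smul_const h).const_add a
    have h2 := (hf1 _ (hseg t ht)).hasFDerivAt.comp_hasDerivAt t h1
    have h3 := (hasDerivAt_id t).mul_const ⟪f' a, h⟫_ℝ
    have h4 := ((hasDerivAt_id t).pow 2).mul_const (1/2 * ⟪h, f'' a h⟫_ℝ)
    refine (((h2.sub h3).sub h4).congr_deriv ?_).hasDerivWithinAt
    simp only [InnerProductSpace.toDual_apply_apply, inner_sub_left, inner_smul_left,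
      real_inner_comm h (f'' a h), id]
    simp
    ring
  have hbound : ∀ t ∈ Icc (0:ℝ) 1,
      ‖⟪f' (a + t • h) - f' a - t • f'' a h, h⟫_ℝ‖ ≤ K * ‖h‖ ^ 3 := by
    intro t ht
    refine (norm_inner_le_norm _ _).trans ?_
    refine (mul_le_mul_of_nonneg_right (hgrad t ht) (norm_nonneg _)).trans_eq (by ring)
  have := (convex_Icc (0:ℝ) 1).norm_image_sub_le_of_norm_hasDerivWithin_le hderiv hbound
    (left_mem_Icc.2 zero_le_one) (right_mem_Icc.2 zero_le_one)
  have hab : a + h = b := by simp [hh]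
  simp only [zero_smul, add_zero, one_smul, hab] at this
  have h5 := (le_abs_self _).trans this
  norm_num at h5
  linarith

/-- On a bounded convex set, a bound on the Hessian bounds the gradient and the function. -/
theorem exists_bound_of_hessian_bound
    {X : Type*} [NormedAddCommGroup X] [InnerProductSpace ℝ X] [CompleteSpace X]
    {f : X → ℝ} {f' : X → X} {f'' : X → X →L[ℝ] X} {S : Set X} (hS : Convex ℝ S)
    (hSb : Bornology.IsBounded S)
    (hf1 : ∀ z ∈ S, HasGradientAt f (f' z) z) (hf2 : ∀ z ∈ S, HasFDerivAt f' (f'' z) z)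
    {M : ℝ} (hM : ∀ z ∈ S, ‖f'' z‖ ≤ M) :
    ∃ C : ℝ, 0 ≤ C ∧ ∀ z ∈ S, |f z| ≤ C ∧ ‖f' z‖ ≤ C ∧ ‖f'' z‖ ≤ C := by
  rcases S.eq_empty_or_nonempty with rfl | ⟨a, ha⟩
  · exact ⟨0, le_rfl, by simp⟩
  obtain ⟨D, hD⟩ := Metric.isBounded_iff.1 hSb
  have hD' : ∀ z ∈ S, ‖z - a‖ ≤ D := fun z hz => by
    simpa [dist_eq_norm] using hD hz ha
  have hD0 : 0 ≤ D := (norm_nonneg _).trans (hD' a ha)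
  have hM0 : 0 ≤ M := (norm_nonneg _).trans (hM a ha)
  have h1 : ∀ z ∈ S, ‖f' z‖ ≤ ‖f' a‖ + M * D := by
    intro z hz
    have := hS.norm_image_sub_le_of_norm_hasFDerivWithin_le
      (fun w hw => (hf2 w hw).hasFDerivWithinAt) hM ha hz
    have h2 := mul_le_mul_of_nonneg_left (hD' z hz) hM0
    linarith [norm_le_norm_add_norm_sub' (f' z) (f' a)]
  have h2 : ∀ z ∈ S, |f z| ≤ |f a| + (‖f' a‖ + M * D) * D := by
    intro z hz
    have := hS.norm_image_sub_le_of_norm_hasFDerivWithin_le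
      (fun w hw => (hf1 w hw).hasFDerivAt.hasFDerivWithinAt)
      (fun w hw => by simpa using h1 w hw) ha hz
    have h3 := mul_le_mul_of_nonneg_left (hD' z hz) (by positivity : 0 ≤ ‖f' a‖ + M * D)
    have h4 := norm_le_norm_add_norm_sub' (f z) (f a)
    simp only [Real.norm_eq_abs] at this h4
    linarith
  refine ⟨max (|f a| + (‖f' a‖ + M * D) * D) (max (‖f' a‖ + M * D) M), ?_, fun z hz =>
    ⟨(h2 z hz).trans (le_max_left _ _), (h1 z hz).trans ?_, (hM z hz).trans ?_⟩⟩
  · exact hM0.trans ((le_max_right _ _).trans (le_max_right _ _))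
  · exact (le_max_left _ _).trans (le_max_right _ _)
  · exact (le_max_right _ _).trans (le_max_right _ _)

/-- If the `q`-th power term with weight `l` is dominated by a quadratic at some `d ≥ r`,
then `l` is bounded. -/
theorem weight_le_of_rpow_le_quadratic {q r d l A : ℝ} (hq : 2 ≤ q) (hr : 0 < r) (hr1 : r ≤ 1)
    (hd : r ≤ d) (hA : 0 ≤ A) (h : l / q * d ^ q ≤ A * (1 + d + d ^ 2)) :
    l ≤ 3 * A * q / r ^ q := by
  have hd0 : 0 < d := hr.trans_le hd
  have hdr : 1 ≤ d / r := (one_le_div hr).2 hd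
  have hddr : d ≤ d / r := le_div_self hd0.le hr hr1
  have h2 : (d / r) ^ (2:ℕ) ≤ (d / r) ^ q := by
    rw [← Real.rpow_natCast]
    exact Real.rpow_le_rpow_of_exponent_le hdr (by simpa using hq)
  have h3 : 1 + d + d ^ 2 ≤ 3 * (d / r) ^ q := by nlinarith
  rw [Real.div_rpow hd0.le hr.le] at h3
  have hdq : 0 < d ^ q := Real.rpow_pos_of_pos hd0 q
  have hrq : 0 < r ^ q := Real.rpow_pos_of_pos hr q
  have h4 : l / q * d ^ q ≤ (3 * A / r ^ q) * d ^ q := by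
    refine h.trans ((mul_le_mul_of_nonneg_left h3 hA).trans_eq ?_)
    field_simp
  have h5 := le_of_mul_le_mul_right h4 hdq
  rw [div_le_iff₀ (by linarith)] at h5
  exact h5.trans_eq (by ring)

/-- If the `q`-th power term with weight `l` is dominated by a cubic at some `d ≤ 1`,
then `l` is bounded. -/
theorem weight_le_of_rpow_le_cubic {q d l K s : ℝ} (hq0 : 0 < q) (hq : q ≤ 3) (hd : 0 < d)
    (hd1 : d ≤ 1) (hs : 0 < s) (hK : 0 ≤ K) (h : s * (l / q * d ^ q) ≤ K * d ^ 3) :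
    l ≤ q * K / s := by
  have h3 : d ^ (3:ℕ) ≤ d ^ q := by
    rw [← Real.rpow_natCast]
    exact Real.rpow_le_rpow_of_exponent_ge hd hd1 (by simpa using hq)
  have hdq : 0 < d ^ q := Real.rpow_pos_of_pos hd q
  have h4 : (s * (l / q)) * d ^ q ≤ K * d ^ q := by
    have := mul_le_mul_of_nonneg_left h3 hK
    linarith
  have h5 := le_of_mul_le_mul_right h4 hdq
  rw [le_div_iff₀ hs]
  rw [← mul_div_assoc, div_le_iff₀ hq0] at h5
  linarith

/-- The effective domain of an extended-real-valued convex function is convex. -/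
theorem convex_setOf_ne_top {X : Type*} [AddCommGroup X] [Module ℝ X] {g : X → EReal}
    (hgnebot : ∀ z : X, g z ≠ ⊥)
    (hgconv : ∀ u w : X, ∀ t : ℝ, t ∈ Set.Ioo (0:ℝ) 1 →
        g (t • u + (1 - t) • w) ≤ (t : EReal) * g u + ((1 - t : ℝ) : EReal) * g w) :
    Convex ℝ {z : X | g z ≠ ⊤} := by
  rw [convex_iff_forall_pos]
  intro u hu w hw a b ha hb hab
  obtain rfl : b = 1 - a := by linarith
  refine ne_top_of_le_ne_top ?_ (hgconv u w a ⟨ha, by linarith⟩)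
  rw [← EReal.coe_toReal hu (hgnebot u), ← EReal.coe_toReal hw (hgnebot w)]
  norm_cast
  exact EReal.coe_ne_top _

/-- Proposition 3.2(iv): under Assumption 2, for each cluster point x̄ of {x^k} there is a
subsequence along which both x^k and F(x^k) converge to x̄ and F(x̄); consequently the whole
sequence F(x^k) converges to F(x̄), so F is constant on ω(x⁰). -/
theorem objective_constant_on_cluster_set
    {X : Type*} [NormedAddCommGroup X] [InnerProductSpace ℝ X] [FiniteDimensional ℝ X]
    -- the data of problem (1): f twice continuously differentiable on an open set O ⊇ dom g,
    -- g proper lsc convex, F = f + g bounded below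
    (f : X → ℝ) (g : X → EReal) (f' : X → X) (f'' : X → X →L[ℝ] X)
    (O : Set X) (hO : IsOpen O) (hOdom : {z : X | g z ≠ ⊤} ⊆ O)
    (hgproper : ∃ z : X, g z ≠ ⊤) (hgnebot : ∀ z : X, g z ≠ ⊥)
    (hglsc : LowerSemicontinuous g)
    (hgconv : ∀ u w : X, ∀ t : ℝ, t ∈ Set.Ioo (0:ℝ) 1 →
        g (t • u + (1 - t) • w) ≤ (t : EReal) * g u + ((1 - t : ℝ) : EReal) * g w)
    (hf1 : ∀ z ∈ O, HasGradientAt f (f' z) z)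
    (hf2 : ∀ z ∈ O, HasFDerivAt f' (f'' z) z)
    (hf2c : ContinuousOn f'' O)
    -- the proximal mapping of g
    (proxg : X → X)
    (hproxg : ∀ w z : X,
        ((1/2 * ‖proxg w - w‖ ^ 2 : ℝ) : EReal) + g (proxg w) ≤
          ((1/2 * ‖z - w‖ ^ 2 : ℝ) : EReal) + g z)
    (F : X → EReal) (hF : ∀ z : X, F z = (f z : EReal) + g z)
    (hFbdd : ∃ m : ℝ, ∀ z : X, (m : EReal) ≤ F z)
    -- Algorithm 1 parameters
    (q Lmin Lmax ϱ σ τ : ℝ)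
    (hq : q ∈ Set.Icc (2:ℝ) 3) (hLmin : 0 < Lmin) (hLmm : Lmin < Lmax)
    (hϱ : ϱ ∈ Set.Ioo (0:ℝ) 1) (hσ : σ ∈ Set.Ioo (0:ℝ) 1) (hτ : 1 < τ)
    -- the sequences generated by Algorithm 1
    (x y v : ℕ → X) (L L0 : ℕ → ℝ) (j : ℕ → ℕ)
    (hx0 : g (x 0) ≠ ⊤)
    (hL0 : ∀ k : ℕ, L0 k ∈ Set.Icc Lmin Lmax)
    (hLdef : ∀ k : ℕ, L k = τ ^ j k * L0 k)
    -- the quadratic model ϑ_k, the regularized model objective Θ_{k,L} and its KKT residual map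
    (ϑ : ℕ → X → ℝ)
    (hϑ : ∀ k : ℕ, ∀ z : X, ϑ k z = f (x k) + ⟪f' (x k), z - x k⟫_ℝ
        + 1/2 * ⟪z - x k, f'' (x k) (z - x k)⟫_ℝ)
    (Θ : ℕ → ℝ → X → EReal)
    (hΘ : ∀ k : ℕ, ∀ l : ℝ, ∀ z : X,
        Θ k l z = ((ϑ k z + l / q * ‖z - x k‖ ^ q : ℝ) : EReal) + g z)
    (Rk : ℕ → ℝ → X → X)
    (hRk : ∀ k : ℕ, ∀ l : ℝ, ∀ z : X, Rk k l z = z - proxg (z -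
        (f' (x k) + f'' (x k) (z - x k) + (l * ‖z - x k‖ ^ (q - 2)) • (z - x k))))
    -- inexactness criterion and descent condition at each iteration
    (hydom : ∀ k : ℕ, g (y k) ≠ ⊤)
    (hinex1 : ∀ k : ℕ, ‖Rk k (L k) (y k)‖ ≤ ϱ * L k * ‖y k - x k‖ ^ (q - 1))
    (hinex2 : ∀ k : ℕ, Θ k (L k) (y k) < Θ k (L k) (x k))
    (hdesc : ∀ k : ℕ, F (y k) ≤ F (x k) - ((σ * L k / q * ‖y k - x k‖ ^ q : ℝ) : EReal))
    (hv : ∀ k : ℕ, v k = Rk k (L k) (y k))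
    (hxsucc : ∀ k : ℕ, x (k + 1) = if F (y k) < F (y k - v k) then y k else y k - v k)
    -- if j_k ≥ 1, the previous trial point failed the descent test
    (hback : ∀ k : ℕ, 1 ≤ j k → ∃ yt : X, g yt ≠ ⊤ ∧
        ‖Rk k (L k / τ) yt‖ ≤ ϱ * (L k / τ) * ‖yt - x k‖ ^ (q - 1) ∧
        Θ k (L k / τ) yt < Θ k (L k / τ) (x k) ∧
        F (x k) - ((σ * (L k / τ) / q * ‖yt - x k‖ ^ q : ℝ) : EReal) < F yt)
    -- Assumption 2: bounded level set; ∇²f locally Lipschitz on an open convex set N ⊇ ω(x⁰)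
    (hlevel : Bornology.IsBounded {z : X | F z ≤ F (x 0)})
    (N : Set X) (hNopen : IsOpen N) (hNconv : Convex ℝ N)
    (hNomega : {z : X | MapClusterPt z atTop x} ⊆ N)
    (hHloc : ∀ z ∈ N, ∃ K : ℝ, 0 < K ∧ ∃ δ : ℝ, 0 < δ ∧
        ∀ a ∈ Metric.ball z δ ∩ N, ∀ b ∈ Metric.ball z δ ∩ N,
          ‖f'' a - f'' b‖ ≤ K * ‖a - b‖) :
    ∀ xb : X, MapClusterPt xb atTop x →
      (∃ φ : ℕ → ℕ, StrictMono φ ∧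
          Tendsto (fun ν : ℕ => x (φ ν)) atTop (𝓝 xb) ∧
          Tendsto (fun ν : ℕ => F (x (φ ν))) atTop (𝓝 (F xb))) ∧
      Tendsto (fun k : ℕ => F (x k)) atTop (𝓝 (F xb)) := by
  have hq0 : 0 < q := by linarith [hq.1]
  obtain ⟨z₀, hz₀⟩ := hgproper
  have hproxdom : ∀ w, g (proxg w) ≠ ⊤ := by
    intro w hw
    have h := hproxg w z₀
    rw [hw, EReal.coe_add_top, top_le_iff] at h
    exact (EReal.add_ne_top (EReal.coe_ne_top _) hz₀) h
  obtain ⟨G, hG⟩ : ∃ G : X → ℝ, ∀ z, g z ≠ ⊤ → g z = (G z : EReal) :=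
    ⟨fun z => (g z).toReal, fun z hz => (EReal.coe_toReal hz (hgnebot z)).symm⟩
  have hFG : ∀ z, g z ≠ ⊤ → F z = ((f z + G z : ℝ) : EReal) := fun z hz => by
    rw [hF, hG z hz, EReal.coe_add]
  -- the auxiliary points and the iterates stay in the domain
  have hyv : ∀ k, ∃ w, w = y k - (f' (x k) + f'' (x k) (y k - x k) +
      (L k * ‖y k - x k‖ ^ (q - 2)) • (y k - x k)) ∧ y k - v k = proxg w := fun k =>
    ⟨_, rfl, by rw [hv, hRk, sub_sub_cancel]⟩
  choose u hu hyvu using hyv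
  have hyvdom : ∀ k, g (y k - v k) ≠ ⊤ := fun k => by rw [hyvu]; exact hproxdom _
  have hxdom : ∀ k, g (x k) ≠ ⊤ := by
    intro k
    cases k with
    | zero => exact hx0
    | succ k =>
      rw [hxsucc]
      split_ifs
      exacts [hydom k, hyvdom k]
  have hFsucc : ∀ k, F (x (k + 1)) ≤ F (y k) ∧ F (x (k + 1)) ≤ F (y k - v k) := by
    intro k
    rw [hxsucc]
    split_ifs with h
    exacts [⟨le_rfl, h.le⟩, ⟨not_lt.1 h, le_rfl⟩]
  have hΦy : ∀ k, f (x (k + 1)) + G (x (k + 1)) ≤ f (y k) + G (y k) := fun k => by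
    have := (hFsucc k).1
    rwa [hFG _ (hxdom _), hFG _ (hydom k), EReal.coe_le_coe_iff] at this
  have hΦyv : ∀ k, f (x (k + 1)) + G (x (k + 1)) ≤ f (y k - v k) + G (y k - v k) := fun k => by
    have := (hFsucc k).2
    rwa [hFG _ (hxdom _), hFG _ (hyvdom k), EReal.coe_le_coe_iff] at this
  have hdescR : ∀ k, f (y k) + G (y k) ≤
      f (x k) + G (x k) - σ * L k / q * ‖y k - x k‖ ^ q := fun k => by
    have := hdesc k
    rwa [hFG _ (hxdom _), hFG _ (hydom k), ← EReal.coe_sub, EReal.coe_le_coe_iff] at this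
  have hLk : ∀ k, Lmin ≤ L k := fun k => by
    rw [hLdef]
    exact (hL0 k).1.trans (le_mul_of_one_le_left (hLmin.le.trans (hL0 k).1)
      (one_le_pow₀ hτ.le))
  have hLpos : ∀ k, 0 < L k := fun k => hLmin.trans_le (hLk k)
  -- monotone convergence of the objective values
  obtain ⟨Φ, hΦ⟩ : ∃ Φ : ℕ → ℝ, ∀ k, Φ k = f (x k) + G (x k) := ⟨_, fun _ => rfl⟩
  have hFΦ : ∀ k, F (x k) = (Φ k : EReal) := fun k => by rw [hΦ, hFG _ (hxdom k)]
  have hgap : ∀ k, σ * L k / q * ‖y k - x k‖ ^ q ≤ Φ k - Φ (k + 1) := fun k => by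
    rw [hΦ, hΦ]; linarith [hΦy k, hdescR k]
  have hanti : Antitone Φ := antitone_nat_of_succ_le fun k => by
    have h1 : 0 ≤ σ * L k / q * ‖y k - x k‖ ^ q :=
      mul_nonneg (div_nonneg (mul_nonneg hσ.1.le (hLpos k).le) hq0.le) (by positivity)
    linarith [hgap k]
  obtain ⟨m, hm⟩ := hFbdd
  have hbdd : BddBelow (Set.range Φ) := ⟨m, by
    rintro _ ⟨k, rfl⟩
    have := hm (x k)
    rwa [hFΦ, EReal.coe_le_coe_iff] at this⟩
  obtain ⟨ℓ, hℓ⟩ : ∃ ℓ, Tendsto Φ atTop (𝓝 ℓ) := ⟨_, tendsto_atTop_ciInf hanti hbdd⟩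
  -- steps vanish
  have hstep : Tendsto (fun k => ‖y k - x k‖) atTop (𝓝 0) := by
    have hc : 0 < σ * Lmin / q := div_pos (mul_pos hσ.1 hLmin) hq0
    have h1 : Tendsto (fun k => (Φ k - Φ (k + 1)) / (σ * Lmin / q)) atTop (𝓝 0) := by
      simpa using (hℓ.sub (hℓ.comp (tendsto_add_atTop_nat 1))).div_const (σ * Lmin / q)
    have h2 : Tendsto (fun k => ‖y k - x k‖ ^ q) atTop (𝓝 0) := by
      refine squeeze_zero (fun k => by positivity) (fun k => ?_) h1
      rw [le_div_iff₀ hc, mul_comm]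
      refine le_trans (mul_le_mul_of_nonneg_right ?_ (by positivity)) (hgap k)
      exact div_le_div_of_nonneg_right (mul_le_mul_of_nonneg_left (hLk k) hσ.1.le) hq0.le
    have h3 := h2.rpow_const (p := q⁻¹) (Or.inr (inv_nonneg.2 hq0.le))
    rw [Real.zero_rpow (inv_ne_zero hq0.ne')] at h3
    exact h3.congr fun k => Real.rpow_rpow_inv (norm_nonneg _) hq0.ne'
  intro xb hxb
  -- a neighbourhood of the cluster point with uniform bounds on the domain
  obtain ⟨K, hK, δ₀, hδ₀, hLip₀⟩ := hHloc xb (hNomega hxb)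
  obtain ⟨δ₁, hδ₁, hδN⟩ := Metric.isOpen_iff.1 hNopen xb (hNomega hxb)
  obtain ⟨r, hr, hr1, hrδ₀, hrδ₁⟩ : ∃ r : ℝ, 0 < r ∧ r ≤ 1 ∧ r + r ≤ δ₀ ∧ r + r ≤ δ₁ := by
    refine ⟨min 1 (min (δ₀ / 2) (δ₁ / 2)), by positivity, min_le_left _ _, ?_, ?_⟩
    · linarith [(min_le_right 1 _).trans (min_le_left (δ₀ / 2) (δ₁ / 2))]
    · linarith [(min_le_right 1 _).trans (min_le_right (δ₀ / 2) (δ₁ / 2))]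
  have hball : ∀ z ∈ ball xb (r + r), z ∈ ball xb δ₀ ∩ N := fun z hz =>
    ⟨ball_subset_ball hrδ₀ hz, hδN (ball_subset_ball hrδ₁ hz)⟩
  have hxbball : xb ∈ ball xb (r + r) := mem_ball_self (by positivity)
  obtain ⟨S, hS⟩ : ∃ S, S = {z : X | g z ≠ ⊤} ∩ ball xb (r + r) := ⟨_, rfl⟩
  have hSconv : Convex ℝ S := hS ▸ (convex_setOf_ne_top hgnebot hgconv).inter (convex_ball _ _)
  have hSO : ∀ z ∈ S, z ∈ O := fun z hz => hOdom (hS ▸ hz).1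
  have hSLip : ∀ a ∈ S, ∀ b ∈ S, ‖f'' a - f'' b‖ ≤ K * ‖a - b‖ := by
    rw [hS]
    exact fun a ha b hb => hLip₀ a (hball a ha.2) b (hball b hb.2)
  have hSM : ∀ z ∈ S, ‖f'' z‖ ≤ ‖f'' xb‖ + K * (r + r) := by
    rw [hS]
    intro z hz
    have h1 := hLip₀ z (hball z hz.2) xb (hball xb hxbball)
    have h2 : ‖z - xb‖ ≤ r + r := (mem_ball_iff_norm.1 hz.2).le
    have h3 := mul_le_mul_of_nonneg_left h2 hK.le
    linarith [norm_le_norm_add_norm_sub' (f'' z) (f'' xb)]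
  have hSf1 : ∀ z ∈ S, HasGradientAt f (f' z) z := fun z hz => hf1 z (hSO z hz)
  have hSf2 : ∀ z ∈ S, HasFDerivAt f' (f'' z) z := fun z hz => hf2 z (hSO z hz)
  obtain ⟨C, hC0, hC⟩ := exists_bound_of_hessian_bound hSconv
    (isBounded_ball.subset (hS ▸ inter_subset_right)) hSf1 hSf2 hSM
  have hGx : ∀ k, x k ∈ S → G (x k) ≤ Φ 0 + C := fun k hk => by
    have h1 := hanti (Nat.zero_le k)
    have h2 := (abs_le.1 (hC _ hk).1).1
    linarith [hΦ k]
  -- local bound on the regularization weights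
  have hLbdd : ∃ M : ℝ, ∀ k, x k ∈ ball xb r → L k ≤ M := by
    obtain ⟨c₀, hc₀⟩ : ∃ c₀ : ℝ, ∀ z, g z ≠ ⊤ → c₀ ≤ 1/2 * ‖z - xb‖ ^ 2 + G z := by
      refine ⟨1/2 * ‖proxg xb - xb‖ ^ 2 + G (proxg xb), fun z hz => ?_⟩
      have := hproxg xb z
      rwa [hG _ (hproxdom _), hG z hz, ← EReal.coe_add, ← EReal.coe_add,
        EReal.coe_le_coe_iff] at this
    obtain ⟨A, hA⟩ : ∃ A : ℝ, A = |Φ 0| + C + |c₀| + 1 := ⟨_, rfl⟩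
    refine ⟨max Lmax (τ * max (3 * A * q / r ^ q) (q * K / (1 - σ))), fun k hk => ?_⟩
    rcases Nat.eq_zero_or_pos (j k) with hj | hj
    · refine le_max_of_le_left ?_
      rw [hLdef, hj, pow_zero, one_mul]
      exact (hL0 k).2
    refine le_max_of_le_right ?_
    obtain ⟨yt, hyt, -, hmodel, hfail⟩ := hback k hj
    have hxS : x k ∈ S := by
      rw [hS]
      exact ⟨hxdom k, ball_subset_ball (by linarith) hk⟩
    rw [← div_le_iff₀' (by linarith)]
    set l := L k / τ with hl
    have hl0 : 0 < l := div_pos (hLpos k) (by linarith)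
    rw [hΘ, hΘ, hϑ, hϑ, hG _ hyt, hG _ (hxdom k), ← EReal.coe_add, ← EReal.coe_add,
      EReal.coe_lt_coe_iff] at hmodel
    rw [hFG _ hyt, hFG _ (hxdom k), ← EReal.coe_sub, EReal.coe_lt_coe_iff] at hfail
    have hne : yt ≠ x k := by
      rintro rfl
      exact lt_irrefl _ hmodel
    simp only [sub_self, norm_zero, Real.zero_rpow hq0.ne', inner_zero_right, map_zero, mul_zero,
      add_zero] at hmodel
    have hd0 : 0 < ‖yt - x k‖ := norm_pos_iff.2 (sub_ne_zero.2 hne)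
    have hxr : ‖x k - xb‖ < r := mem_ball_iff_norm.1 hk
    have htri : ‖yt - xb‖ ≤ ‖yt - x k‖ + ‖x k - xb‖ := by
      simpa using norm_add_le (yt - x k) (x k - xb)
    obtain ⟨hCf, hCf', hCf''⟩ := hC _ hxS
    rcases le_or_gt r ‖yt - x k‖ with hrd | hrd
    · refine le_max_of_le_left (weight_le_of_rpow_le_quadratic hq.1 hr hr1 hrd
        (by rw [hA]; positivity) ?_)
      set d := ‖yt - x k‖ with hd
      have h1 : |⟪f' (x k), yt - x k⟫_ℝ| ≤ C * d :=
        (abs_real_inner_le_norm _ _).trans (mul_le_mul_of_nonneg_right hCf' hd0.le)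
      have h2 : |⟪yt - x k, f'' (x k) (yt - x k)⟫_ℝ| ≤ C * d ^ 2 := by
        refine (abs_real_inner_le_norm _ _).trans ?_
        have := (ContinuousLinearMap.le_opNorm (f'' (x k)) (yt - x k)).trans
          (mul_le_mul_of_nonneg_right hCf'' hd0.le)
        refine (mul_le_mul_of_nonneg_left this hd0.le).trans_eq (by ring)
      have h3 : ‖yt - xb‖ ^ 2 ≤ (d + 1) ^ 2 :=
        pow_le_pow_left₀ (norm_nonneg _) (by linarith) 2
      have h4 := hc₀ yt hyt
      have h5 := hGx k hxS
      have h6 := (abs_le.1 h1).1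
      have h7 := (abs_le.1 h2).1
      have h8 := neg_abs_le c₀
      have h9 := le_abs_self (Φ 0)
      have h10 : 0 ≤ (|Φ 0| + |c₀| + 1) * d := by positivity
      have h11 : 0 ≤ (|Φ 0| + |c₀|) * d ^ 2 := by positivity
      have h12 : 0 ≤ C * d ^ 2 := by positivity
      rw [hA]
      nlinarith [sq_nonneg (d - 1)]
    · refine le_max_of_le_right (weight_le_of_rpow_le_cubic hq0 hq.2 hd0 (hrd.le.trans hr1)
        (by linarith [hσ.2]) hK.le ?_)
      have hyS : yt ∈ S := by
        rw [hS]
        exact ⟨hyt, mem_ball_iff_norm.2 (by linarith)⟩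
      have htay := le_taylor_two_of_lipschitz_hessian hSconv hSf1 hSf2 hK.le hSLip hxS hyS
      have : σ * l / q * ‖yt - x k‖ ^ q = σ * (l / q * ‖yt - x k‖ ^ q) := by ring
      linarith
  obtain ⟨M, hM⟩ := hLbdd
  obtain ⟨φ, hφ, hφx⟩ := hxb.tendsto_subseq
  have hφt := hφ.tendsto_atTop
  have hφΦ : Tendsto (fun n => Φ (φ n)) atTop (𝓝 ℓ) := hℓ.comp hφt
  have hφr : ∀ᶠ n in atTop, x (φ n) ∈ ball xb r := hφx (ball_mem_nhds xb hr)
  -- the cluster point lies in the domain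
  have hsub : ∀ c : ℝ, (∀ᶠ n in atTop, G (x (φ n)) ≤ c) → g xb ≤ c := by
    intro c hc
    refine (hglsc.isClosed_preimage (c : EReal)).mem_of_tendsto hφx ?_
    filter_upwards [hc] with n hn
    change g (x (φ n)) ≤ c
    rw [hG _ (hxdom _)]
    exact EReal.coe_le_coe_iff.2 hn
  have hxbdom : g xb ≠ ⊤ := by
    refine ne_top_of_le_ne_top (EReal.coe_ne_top _) (hsub (Φ 0 + C) ?_)
    filter_upwards [hφr] with n hn
    exact hGx _ (hS ▸ ⟨hxdom _, ball_subset_ball (by linarith) hn⟩)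
  have hxbO := hOdom hxbdom
  have hfc : ContinuousAt f xb := (hf1 xb hxbO).hasFDerivAt.continuousAt
  have hf'c : ContinuousAt f' xb := (hf2 xb hxbO).continuousAt
  have hf''c : ContinuousAt f'' xb := hf2c.continuousAt (hO.mem_nhds hxbO)
  have hlower : f xb + G xb ≤ ℓ := by
    have h1 : Tendsto (fun n => Φ (φ n) - f (x (φ n))) atTop (𝓝 (ℓ - f xb)) :=
      hφΦ.sub (hfc.tendsto.comp hφx)
    have h2 : G xb ≤ ℓ - f xb := by
      refine le_of_forall_gt_imp_ge_of_dense fun c hc => ?_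
      rw [← EReal.coe_le_coe_iff, ← hG xb hxbdom]
      refine hsub c ?_
      filter_upwards [h1.eventually_lt_const hc] with n hn
      linarith [hΦ (φ n)]
    linarith
  -- the prox points converge to the cluster point
  have hφd : Tendsto (fun n => ‖y (φ n) - x (φ n)‖) atTop (𝓝 0) := hstep.comp hφt
  have hφd' : Tendsto (fun n => y (φ n) - x (φ n)) atTop (𝓝 0) :=
    tendsto_zero_iff_norm_tendsto_zero.2 hφd
  have hφy : Tendsto (fun n => y (φ n)) atTop (𝓝 xb) := by simpa using hφd'.add hφx
  have hφMd : Tendsto (fun n => M * ‖y (φ n) - x (φ n)‖) atTop (𝓝 0) := by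
    simpa using hφd.const_mul M
  have hφ1 : ∀ᶠ n in atTop, ‖y (φ n) - x (φ n)‖ ≤ 1 := hφd.eventually_le_const one_pos
  have hφv : Tendsto (fun n => v (φ n)) atTop (𝓝 0) := by
    refine squeeze_zero_norm' ?_ hφMd
    filter_upwards [hφ1, hφr] with n hn hnr
    have h1 : ‖y (φ n) - x (φ n)‖ ^ (q - 1) ≤ ‖y (φ n) - x (φ n)‖ := by
      simpa using Real.rpow_le_rpow_of_exponent_ge' (norm_nonneg _) hn zero_le_one
        (by linarith [hq.1] : (1:ℝ) ≤ q - 1)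
    rw [hv]
    refine (hinex1 _).trans (mul_le_mul ?_ h1 (by positivity) ((hLpos _).le.trans (hM _ hnr)))
    exact (mul_le_of_le_one_left (hLpos _).le hϱ.2.le).trans (hM _ hnr)
  have hφp : Tendsto (fun n => y (φ n) - v (φ n)) atTop (𝓝 xb) := by simpa using hφy.sub hφv
  have hφreg : Tendsto (fun n => (L (φ n) * ‖y (φ n) - x (φ n)‖ ^ (q - 2)) •
      (y (φ n) - x (φ n))) atTop (𝓝 0) := by
    refine squeeze_zero_norm' ?_ hφMd
    filter_upwards [hφ1, hφr] with n hn hnr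
    have h1 : ‖y (φ n) - x (φ n)‖ ^ (q - 2) ≤ 1 :=
      Real.rpow_le_one (norm_nonneg _) hn (by linarith [hq.1])
    rw [norm_smul, Real.norm_of_nonneg (mul_nonneg (hLpos _).le (by positivity))]
    refine mul_le_mul_of_nonneg_right ?_ (norm_nonneg _)
    exact (mul_le_of_le_one_right (hLpos _).le h1).trans (hM _ hnr)
  have hφu : Tendsto (fun n => u (φ n)) atTop (𝓝 (xb - f' xb)) := by
    have h1 : Tendsto (fun n => f'' (x (φ n)) (y (φ n) - x (φ n))) atTop (𝓝 (f'' xb 0)) :=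
      (isBoundedBilinearMap_apply.continuous.tendsto (f'' xb, (0 : X))).comp
        ((hf''c.tendsto.comp hφx).prodMk_nhds hφd')
    have h2 := hφy.sub (((hf'c.tendsto.comp hφx).add h1).add hφreg)
    simp only [map_zero, add_zero] at h2
    exact h2.congr fun n => (hu (φ n)).symm
  have hupper : ℓ ≤ f xb + G xb := by
    have h1 : ∀ n, Φ (φ n + 1) ≤ f (y (φ n) - v (φ n)) + G xb +
        (1/2 * ‖xb - u (φ n)‖ ^ 2 - 1/2 * ‖y (φ n) - v (φ n) - u (φ n)‖ ^ 2) := by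
      intro n
      have h2 := hproxg (u (φ n)) xb
      rw [← hyvu, hG _ (hyvdom _), hG _ hxbdom, ← EReal.coe_add, ← EReal.coe_add,
        EReal.coe_le_coe_iff] at h2
      rw [hΦ]
      linarith [hΦyv (φ n)]
    have h3 : Tendsto (fun n => Φ (φ n + 1)) atTop (𝓝 ℓ) :=
      (hℓ.comp (tendsto_add_atTop_nat 1)).comp hφt
    have h4 := ((hfc.tendsto.comp hφp).add_const (G xb)).add
      (((((tendsto_const_nhds (x := xb)).sub hφu).norm.pow 2).const_mul (1/2)).sub
        (((hφp.sub hφu).norm.pow 2).const_mul (1/2)))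
    simpa using le_of_tendsto_of_tendsto' h3 h4 h1
  have hmain : Tendsto (fun k => F (x k)) atTop (𝓝 (F xb)) := by
    rw [hFG xb hxbdom, ← le_antisymm hupper hlower]
    simp only [hFΦ]
    exact (continuous_coe_real_ereal.tendsto ℓ).comp hℓ
  exact ⟨⟨φ, hφ, hφx, hmain.comp hφt⟩, hmain⟩
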